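/- Let φ : ℝ → ℂ be a bounded measurable function satisfying φ(q + √2 m) = e^{2πiαm} φ(q) for almost every q ∈ ℝ and every m ∈ ℤ. Then the Bargmann transform (Bφ)(z) = (ν/π)^{3/4} ∫_ℝ φ(q) e^{−(ν/2)(z² + q²) + ν√2 z q} dq is well defined, is an entire function of z, and satisfies the quasi-periodicity equation (Bφ)(z+m) = e^{2πiαm} e^{ν(z+m/2)m} (Bφ)(z) for all z ∈ ℂ and all m ∈ ℤ. -/

import Mathlib

open Complex MeasureTheory

/-- A Gaussian times `exp (c * |q|)` is integrable. -/
lemma integrable_exp_neg_mul_sq_add_mul_abs {b : ℝ} (hb : 0 < b) (c : ℝ) :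
    Integrable fun q : ℝ => Real.exp (-b * q ^ 2 + c * |q|) := by
  have key (d : ℝ) : Integrable fun q : ℝ => Real.exp (-b * q ^ 2 + d * q) := by
    have h := (integrable_cexp_quadratic' (b := (-b : ℂ)) (by simpa using hb) d 0).norm
    refine h.congr (ae_of_all _ fun q => ?_)
    simp [Complex.norm_exp, ← Complex.ofReal_pow]
  refine ((key c).add (key (-c))).mono' (by fun_prop) (ae_of_all _ fun q => ?_)
  rw [Real.norm_of_nonneg (Real.exp_pos _).le]
  rcases abs_choice q with h | h
  · rw [h]
    exact le_add_of_nonneg_right (Real.exp_pos _).le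
  · rw [h, mul_neg, ← neg_mul]
    exact le_add_of_nonneg_left (Real.exp_pos _).le

lemma norm_cexp_neg_mul_sq_add_mul_le (b : ℝ) {z : ℂ} {R : ℝ} (hz : ‖z‖ ≤ R) (q : ℝ) :
    ‖cexp (-b * (q : ℂ) ^ 2 + z * q)‖ ≤ Real.exp (-b * q ^ 2 + R * |q|) := by
  have hre : (-b * (q : ℂ) ^ 2 + z * q).re = -b * q ^ 2 + z.re * q := by
    simp [← Complex.ofReal_pow]
  rw [Complex.norm_exp, hre, Real.exp_le_exp]
  have : z.re * q ≤ R * |q| := by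
    calc z.re * q ≤ |z.re * q| := le_abs_self _
      _ = |z.re| * |q| := abs_mul _ _
      _ ≤ R * |q| := by gcongr; exact (Complex.abs_re_le_norm z).trans hz
  linarith

section BoundedMeasurable

variable {b C : ℝ} {φ : ℝ → ℂ}

lemma integrable_mul_cexp_neg_mul_sq_add_mul (hb : 0 < b) (hmeas : Measurable φ)
    (hC : ∀ q, ‖φ q‖ ≤ C) (z : ℂ) :
    Integrable fun q : ℝ => φ q * cexp (-b * (q : ℂ) ^ 2 + z * q) := by
  refine ((integrable_exp_neg_mul_sq_add_mul_abs hb ‖z‖).const_mul C).mono'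
    (by fun_prop) (ae_of_all _ fun q => ?_)
  rw [norm_mul]
  exact mul_le_mul (hC q) (norm_cexp_neg_mul_sq_add_mul_le b le_rfl q) (norm_nonneg _)
    ((norm_nonneg _).trans (hC q))

lemma differentiable_integral_mul_cexp_neg_mul_sq_add_mul (hb : 0 < b) (hmeas : Measurable φ)
    (hC : ∀ q, ‖φ q‖ ≤ C) :
    Differentiable ℂ fun z : ℂ => ∫ q : ℝ, φ q * cexp (-b * (q : ℂ) ^ 2 + z * q) := by
  intro z₀
  refine (hasDerivAt_integral_of_dominated_loc_of_deriv_le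
    (F' := fun z q => φ q * (cexp (-b * (q : ℂ) ^ 2 + z * q) * q))
    (bound := fun q => C * Real.exp (-b * q ^ 2 + (‖z₀‖ + 1 + 1) * |q|))
    (Metric.ball_mem_nhds z₀ one_pos) (Filter.Eventually.of_forall fun z => by fun_prop)
    (integrable_mul_cexp_neg_mul_sq_add_mul hb hmeas hC z₀) (by fun_prop)
    (ae_of_all _ fun q z hz => ?_)
    ((integrable_exp_neg_mul_sq_add_mul_abs hb _).const_mul C)
    (ae_of_all _ fun q z _ => ?_)).2.differentiableAt
  · have hz' : ‖z‖ ≤ ‖z₀‖ + 1 := by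
      have := norm_le_norm_add_norm_sub' z z₀
      rw [Metric.mem_ball, dist_eq_norm] at hz
      linarith
    have hq : |q| ≤ Real.exp |q| := by linarith [Real.add_one_le_exp |q|]
    rw [norm_mul, norm_mul, Complex.norm_real, Real.norm_eq_abs, add_mul _ 1, one_mul,
      ← add_assoc, Real.exp_add _ |q|]
    exact mul_le_mul (hC q)
      (mul_le_mul (norm_cexp_neg_mul_sq_add_mul_le b hz' q) hq (abs_nonneg _)
        (Real.exp_pos _).le) (by positivity) ((norm_nonneg _).trans (hC q))
  · have h : HasDerivAt (fun z : ℂ => -b * (q : ℂ) ^ 2 + z * q) q z := by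
      simpa using ((hasDerivAt_id z).mul_const (q : ℂ)).const_add (-b * (q : ℂ) ^ 2)
    exact h.cexp.const_mul (φ q)

end BoundedMeasurable

lemma bargmann_kernel_eq (ν : ℝ) (z : ℂ) (q : ℝ) :
    cexp (-(ν / 2) * (z ^ 2 + (q : ℂ) ^ 2) + ν * Real.sqrt 2 * z * q) =
      cexp (-(ν / 2) * z ^ 2) *
        cexp (-(ν / 2 : ℝ) * (q : ℂ) ^ 2 + (ν * Real.sqrt 2 * z) * q) := by
  rw [← Complex.exp_add]
  push_cast
  ring_nf

lemma bargmann_kernel_add (ν : ℝ) (z m : ℂ) (q : ℂ) :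
    cexp (-(ν / 2) * ((z + m) ^ 2 + (q + Real.sqrt 2 * m) ^ 2) +
        ν * Real.sqrt 2 * (z + m) * (q + Real.sqrt 2 * m)) =
      cexp (ν * (z + m / 2) * m) *
        cexp (-(ν / 2) * (z ^ 2 + q ^ 2) + ν * Real.sqrt 2 * z * q) := by
  have h2 : ((Real.sqrt 2 : ℝ) : ℂ) ^ 2 = 2 := by
    rw [← Complex.ofReal_pow, Real.sq_sqrt zero_le_two, Complex.ofReal_ofNat]
  rw [← Complex.exp_add]
  congr 1
  linear_combination (ν * (z + m) * m - ν / 2 * m ^ 2) * h2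

/-- For a bounded measurable `φ : ℝ → ℂ` with
`φ(q + √2 m) = e^{2πiαm} φ(q)` for a.e. `q` and every `m ∈ ℤ`, the Bargmann transform
`(Bφ)(z) = (ν/π)^{3/4} ∫_ℝ φ(q) e^{−(ν/2)(z²+q²) + ν√2 zq} dq` is well defined
(the integrand is integrable for every `z`), is an entire function of `z`, and satisfies
the quasi-periodicity equation `(Bφ)(z+m) = e^{2πiαm} e^{ν(z+m/2)m} (Bφ)(z)`. -/
theorem stmt_12 (α ν : ℝ) (hν : 0 < ν) (φ : ℝ → ℂ) (hmeas : Measurable φ)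
    (hbd : ∃ C : ℝ, ∀ q : ℝ, ‖φ q‖ ≤ C)
    (hqp : ∀ m : ℤ, ∀ᵐ q : ℝ, φ (q + Real.sqrt 2 * m) =
        Complex.exp (2 * Real.pi * Complex.I * α * m) * φ q)
    (B : ℂ → ℂ)
    (hB : ∀ z : ℂ, B z = (((ν / Real.pi) ^ ((3 : ℝ) / 4) : ℝ) : ℂ) *
        ∫ q : ℝ, φ q * Complex.exp (-(ν / 2) * (z ^ 2 + (q : ℂ) ^ 2) +
          ν * Real.sqrt 2 * z * q)) :
    (∀ z : ℂ, Integrable (fun q : ℝ =>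
        φ q * Complex.exp (-(ν / 2) * (z ^ 2 + (q : ℂ) ^ 2) + ν * Real.sqrt 2 * z * q))) ∧
      Differentiable ℂ B ∧
      ∀ (z : ℂ) (m : ℤ), B (z + m) =
        Complex.exp (2 * Real.pi * Complex.I * α * m) *
          Complex.exp (ν * (z + m / 2) * m) * B z := by
  obtain ⟨C, hC⟩ := hbd
  have hb : 0 < ν / 2 := half_pos hν
  refine ⟨fun z => ?_, ?_, fun z m => ?_⟩
  · simp_rw [bargmann_kernel_eq, mul_left_comm (φ _)]
    exact (integrable_mul_cexp_neg_mul_sq_add_mul hb hmeas hC _).const_mul _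
  · have hB' : B = fun z => (((ν / Real.pi) ^ ((3 : ℝ) / 4) : ℝ) : ℂ) *
        (cexp (-(ν / 2) * z ^ 2) *
          ∫ q : ℝ, φ q * cexp (-(ν / 2 : ℝ) * (q : ℂ) ^ 2 + (ν * Real.sqrt 2 * z) * q)) := by
      funext z
      rw [hB]
      simp_rw [bargmann_kernel_eq, mul_left_comm (φ _), integral_const_mul]
    have hd := (differentiable_integral_mul_cexp_neg_mul_sq_add_mul hb hmeas hC).comp
      (differentiable_id.const_mul (ν * Real.sqrt 2 : ℂ))
    rw [hB']
    exact (Differentiable.mul (by fun_prop) hd).const_mul _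
  · rw [hB, hB, mul_left_comm]
    congr 1
    rw [← integral_const_mul]
    refine (integral_add_right_eq_self _ (Real.sqrt 2 * m)).symm.trans (integral_congr_ae ?_)
    filter_upwards [hqp m] with q hq
    rw [hq]
    push_cast
    rw [bargmann_kernel_add]
    ring
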